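/- Let L : ℝ² × (Fin 4 → ℝ²) → ℝ be a smooth function of (u, p), invariant under simultaneous rotation of all its arguments: L(R_α u, (μ ↦ R_α (p μ))) = L(u, p) for every angle α ∈ ℝ, where R_α is the rotation of ℝ² by angle α. Let φ : ℝ⁴ → ℝ² be a smooth field satisfying the Euler–Lagrange equations: for each a ∈ Fin 2 and x ∈ ℝ⁴, (∂L/∂u_a)(φ(x), Dφ(x)) = ∑_μ ∂_μ [ (∂L/∂p_{aμ})(φ(x), Dφ(x)) ], where Dφ(x) = (μ ↦ ∂_μ φ(x)). Define the current j^μ(x) := ∑_a (∂L/∂p_{aμ})(φ(x), Dφ(x)) · (Jφ(x))_a, where J : ℝ² → ℝ² is the rotation generator J(u₁, u₂) = (−u₂, u₁). Then ∑_μ ∂_μ j^μ(x) = 0 for all x ∈ ℝ⁴. -/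

import Mathlib

noncomputable section

/-- Partial derivative `∂_μ` of a real-valued function on `ℝ⁴ = Fin 4 → ℝ`. -/
def pd (μ : Fin 4) (f : (Fin 4 → ℝ) → ℝ) (x : Fin 4 → ℝ) : ℝ :=
  fderiv ℝ f x (Pi.single μ 1)

/-- Rotation of `ℝ² = Fin 2 → ℝ` by angle `α`. -/
def rot (α : ℝ) (u : Fin 2 → ℝ) : Fin 2 → ℝ :=
  ![u 0 * Real.cos α - u 1 * Real.sin α, u 0 * Real.sin α + u 1 * Real.cos α]

/-- The rotation generator `J(u₁, u₂) = (−u₂, u₁)`. -/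
def rotGen (u : Fin 2 → ℝ) : Fin 2 → ℝ := ![-(u 1), u 0]

/-- `∂L/∂u_a` for a first-order Lagrangian `L(u, p)`. -/
def DLu (L : (Fin 2 → ℝ) → (Fin 4 → Fin 2 → ℝ) → ℝ) (a : Fin 2)
    (u : Fin 2 → ℝ) (p : Fin 4 → Fin 2 → ℝ) : ℝ :=
  fderiv ℝ (fun v => L v p) u (Pi.single a 1)

/-- `∂L/∂p_{aμ}` for a first-order Lagrangian `L(u, p)`. -/
def DLp (L : (Fin 2 → ℝ) → (Fin 4 → Fin 2 → ℝ) → ℝ) (a : Fin 2) (μ : Fin 4)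
    (u : Fin 2 → ℝ) (p : Fin 4 → Fin 2 → ℝ) : ℝ :=
  fderiv ℝ (fun w => L u w) p (Pi.single μ (Pi.single a 1))

/-- The gradient `Dφ(x) = (μ ↦ ∂_μ φ(x))` of a field `φ : ℝ⁴ → ℝ²`. -/
def Dfield (φ : (Fin 4 → ℝ) → Fin 2 → ℝ) (x : Fin 4 → ℝ) : Fin 4 → Fin 2 → ℝ :=
  fun μ a => pd μ (fun y => φ y a) x

/-- `∂L/∂u_a` is a directional derivative of the uncurried Lagrangian. -/
lemma DLu_eq_fderiv {L : (Fin 2 → ℝ) → (Fin 4 → Fin 2 → ℝ) → ℝ}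
    {u : Fin 2 → ℝ} {p : Fin 4 → Fin 2 → ℝ}
    (hL : DifferentiableAt ℝ
      (fun z : (Fin 2 → ℝ) × (Fin 4 → Fin 2 → ℝ) => L z.1 z.2) (u, p)) (a : Fin 2) :
    DLu L a u p = fderiv ℝ (fun z : (Fin 2 → ℝ) × (Fin 4 → Fin 2 → ℝ) => L z.1 z.2) (u, p)
      (Pi.single a 1, 0) := by
  have h := hL.hasFDerivAt.comp (f := fun v => (v, p)) u (hasFDerivAt_prodMk_left u p)
  have h' : HasFDerivAt (fun v => L v p) _ u := h
  simp [DLu, h'.fderiv]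

/-- `∂L/∂p_{aμ}` is a directional derivative of the uncurried Lagrangian. -/
lemma DLp_eq_fderiv {L : (Fin 2 → ℝ) → (Fin 4 → Fin 2 → ℝ) → ℝ}
    {u : Fin 2 → ℝ} {p : Fin 4 → Fin 2 → ℝ}
    (hL : DifferentiableAt ℝ
      (fun z : (Fin 2 → ℝ) × (Fin 4 → Fin 2 → ℝ) => L z.1 z.2) (u, p)) (a : Fin 2) (μ : Fin 4) :
    DLp L a μ u p = fderiv ℝ (fun z : (Fin 2 → ℝ) × (Fin 4 → Fin 2 → ℝ) => L z.1 z.2) (u, p)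
      (0, Pi.single μ (Pi.single a 1)) := by
  have h := hL.hasFDerivAt.comp (f := fun w => (u, w)) p (hasFDerivAt_prodMk_right u p)
  have h' : HasFDerivAt (fun w => L u w) _ p := h
  simp [DLp, h'.fderiv]

/-- The total derivative of `L` in the direction `(v, q)` in terms of its partial derivatives. -/
lemma fderiv_uncurry_apply {L : (Fin 2 → ℝ) → (Fin 4 → Fin 2 → ℝ) → ℝ}
    {u : Fin 2 → ℝ} {p : Fin 4 → Fin 2 → ℝ}
    (hL : DifferentiableAt ℝ
      (fun z : (Fin 2 → ℝ) × (Fin 4 → Fin 2 → ℝ) => L z.1 z.2) (u, p))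
    (v : Fin 2 → ℝ) (q : Fin 4 → Fin 2 → ℝ) :
    fderiv ℝ (fun z : (Fin 2 → ℝ) × (Fin 4 → Fin 2 → ℝ) => L z.1 z.2) (u, p) (v, q) =
      ∑ a, DLu L a u p * v a + ∑ μ, ∑ a, DLp L a μ u p * q μ a := by
  have hvq : (v, q) = ∑ a, v a • ((Pi.single a 1, 0) : (Fin 2 → ℝ) × (Fin 4 → Fin 2 → ℝ)) +
      ∑ μ, ∑ a, q μ a •
        ((0, Pi.single μ (Pi.single a 1)) : (Fin 2 → ℝ) × (Fin 4 → Fin 2 → ℝ)) := by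
    ext i j
    · fin_cases i <;> simp [Prod.fst_sum]
    · fin_cases i <;> fin_cases j <;> simp [Fin.sum_univ_four]
  rw [hvq]
  simp only [map_add, map_sum, map_smul, smul_eq_mul, DLu_eq_fderiv hL, DLp_eq_fderiv hL, mul_comm]

lemma rot_zero (u : Fin 2 → ℝ) : rot 0 u = u := by
  ext i
  fin_cases i <;> simp [rot]

/-- `rotGen` generates the one-parameter group `rot`. -/
lemma hasDerivAt_rot_zero (u : Fin 2 → ℝ) : HasDerivAt (fun α => rot α u) (rotGen u) 0 := by
  rw [hasDerivAt_pi]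
  intro i
  have hc := Real.hasDerivAt_cos 0
  have hs := Real.hasDerivAt_sin 0
  fin_cases i
  · simpa [rot, rotGen] using (hc.const_mul (u 0)).fun_sub (hs.const_mul (u 1))
  · simpa [rot, rotGen] using (hs.const_mul (u 0)).fun_add (hc.const_mul (u 1))

/-- Infinitesimal form of rotation invariance. -/
lemma sum_DLu_add_sum_DLp_eq_zero_of_rot_invariant
    {L : (Fin 2 → ℝ) → (Fin 4 → Fin 2 → ℝ) → ℝ} {u : Fin 2 → ℝ} {p : Fin 4 → Fin 2 → ℝ}
    (hL : DifferentiableAt ℝ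
      (fun z : (Fin 2 → ℝ) × (Fin 4 → Fin 2 → ℝ) => L z.1 z.2) (u, p))
    (hinv : ∀ α : ℝ, L (rot α u) (fun μ => rot α (p μ)) = L u p) :
    ∑ a, DLu L a u p * rotGen u a + ∑ μ, ∑ a, DLp L a μ u p * rotGen (p μ) a = 0 := by
  have hcurve : HasDerivAt (fun α => (rot α u, fun μ => rot α (p μ)))
      (rotGen u, fun μ => rotGen (p μ)) 0 :=
    (hasDerivAt_rot_zero u).prodMk (hasDerivAt_pi.2 fun μ => hasDerivAt_rot_zero (p μ))
  have hcomp := hL.hasFDerivAt.comp_hasDerivAt_of_eq (0 : ℝ) hcurve (by simp [rot_zero])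
  have hconst : HasDerivAt (fun α => L (rot α u) (fun μ => rot α (p μ))) 0 0 := by
    simpa only [hinv] using hasDerivAt_const (0 : ℝ) (L u p)
  rw [← fderiv_uncurry_apply hL (rotGen u) fun μ => rotGen (p μ)]
  exact hcomp.unique hconst

/-- The Leibniz rule for `pd`. -/
lemma pd_mul {f g : (Fin 4 → ℝ) → ℝ} {x : Fin 4 → ℝ} (hf : DifferentiableAt ℝ f x)
    (hg : DifferentiableAt ℝ g x) (μ : Fin 4) :
    pd μ (fun y => f y * g y) x = pd μ f x * g x + f x * pd μ g x := by
  simp only [pd, fderiv_fun_mul hf hg, add_apply, smul_apply, smul_eq_mul]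
  ring

/-- `pd` commutes with finite sums. -/
lemma pd_sum {ι : Type*} (s : Finset ι) {f : ι → (Fin 4 → ℝ) → ℝ} {x : Fin 4 → ℝ}
    (hf : ∀ i ∈ s, DifferentiableAt ℝ (f i) x) (μ : Fin 4) :
    pd μ (fun y => ∑ i ∈ s, f i y) x = ∑ i ∈ s, pd μ (f i) x := by
  simp [pd, fderiv_fun_sum hf]

lemma pd_rotGen (φ : (Fin 4 → ℝ) → Fin 2 → ℝ) (x : Fin 4 → ℝ) (μ : Fin 4) (a : Fin 2) :
    pd μ (fun y => rotGen (φ y) a) x = rotGen (Dfield φ x μ) a := by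
  fin_cases a <;> simp [rotGen, pd, Dfield, fderiv_fun_neg]

lemma differentiable_rotGen {φ : (Fin 4 → ℝ) → Fin 2 → ℝ} (hφ : Differentiable ℝ φ) (a : Fin 2) :
    Differentiable ℝ (fun y => rotGen (φ y) a) := by
  rw [differentiable_pi] at hφ
  fin_cases a
  · simpa [rotGen] using (hφ 1).fun_neg
  · simpa [rotGen] using hφ 0

lemma differentiable_Dfield {φ : (Fin 4 → ℝ) → Fin 2 → ℝ} (hφ : ContDiff ℝ 2 φ) :
    Differentiable ℝ (Dfield φ) := by
  refine differentiable_pi.2 fun μ => differentiable_pi.2 fun a => ?_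
  have h : ContDiff ℝ 1 (fderiv ℝ fun y => φ y a) :=
    (contDiff_pi.1 hφ a).fderiv_right (by norm_num)
  exact (h.differentiable one_ne_zero).clm_apply (differentiable_const _)

/-- The conjugate momenta `∂L/∂p_{aμ}` along a `C²` field are differentiable. -/
lemma differentiable_DLp_comp {L : (Fin 2 → ℝ) → (Fin 4 → Fin 2 → ℝ) → ℝ}
    (hL : ContDiff ℝ 2 (fun z : (Fin 2 → ℝ) × (Fin 4 → Fin 2 → ℝ) => L z.1 z.2))
    {φ : (Fin 4 → ℝ) → Fin 2 → ℝ} (hφ : ContDiff ℝ 2 φ) (a : Fin 2) (μ : Fin 4) :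
    Differentiable ℝ (fun y => DLp L a μ (φ y) (Dfield φ y)) := by
  simp only [DLp_eq_fderiv (hL.differentiable two_ne_zero _)]
  have h : ContDiff ℝ 1 (fderiv ℝ fun z : (Fin 2 → ℝ) × (Fin 4 → Fin 2 → ℝ) => L z.1 z.2) :=
    hL.fderiv_right (by norm_num)
  exact ((h.differentiable one_ne_zero).comp
    ((hφ.differentiable two_ne_zero).prodMk (differentiable_Dfield hφ))).clm_apply
      (differentiable_const _)

/-- **Noether's theorem for an internal U(1) (rotation) symmetry of a first-order field
theory on flat `ℝ⁴`** (mechanism behind Section 2.5 of the paper, conservation of electric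
charge): if `L(u, p)` is invariant under simultaneous rotation of all arguments and `φ`
solves the Euler–Lagrange equations, then the current
`j^μ = ∑_a (∂L/∂p_{aμ}) (Jφ)_a` is divergence free. -/
theorem noether_internal_rotation_symmetry
    (L : (Fin 2 → ℝ) → (Fin 4 → Fin 2 → ℝ) → ℝ)
    (hL : ContDiff ℝ (⊤ : ℕ∞) (fun z : (Fin 2 → ℝ) × (Fin 4 → Fin 2 → ℝ) => L z.1 z.2))
    (hinv : ∀ (α : ℝ) (u : Fin 2 → ℝ) (p : Fin 4 → Fin 2 → ℝ),
      L (rot α u) (fun μ => rot α (p μ)) = L u p)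
    (φ : (Fin 4 → ℝ) → Fin 2 → ℝ) (hφ : ContDiff ℝ (⊤ : ℕ∞) φ)
    (hEL : ∀ (a : Fin 2) (x : Fin 4 → ℝ),
      DLu L a (φ x) (Dfield φ x) = ∑ μ, pd μ (fun y => DLp L a μ (φ y) (Dfield φ y)) x) :
    ∀ x : Fin 4 → ℝ,
      ∑ μ, pd μ (fun y => ∑ a, DLp L a μ (φ y) (Dfield φ y) * rotGen (φ y) a) x = 0 := by
  intro x
  have hL2 := contDiff_infty.1 hL 2
  have hφ2 := contDiff_infty.1 hφ 2
  have hmom := fun a μ => differentiable_DLp_comp hL2 hφ2 a μ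
  have hgen := differentiable_rotGen (hφ2.differentiable two_ne_zero)
  have hsym := sum_DLu_add_sum_DLp_eq_zero_of_rot_invariant
    (hL2.differentiable two_ne_zero (φ x, Dfield φ x)) fun α => hinv α _ _
  have hdiv (μ : Fin 4) : pd μ (fun y => ∑ a, DLp L a μ (φ y) (Dfield φ y) * rotGen (φ y) a) x =
      ∑ a, pd μ (fun y => DLp L a μ (φ y) (Dfield φ y)) x * rotGen (φ x) a +
        ∑ a, DLp L a μ (φ x) (Dfield φ x) * rotGen (Dfield φ x μ) a := by
    rw [pd_sum _ fun a _ => (hmom a μ x).fun_mul (hgen a x), ← Finset.sum_add_distrib]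
    simp only [pd_mul (hmom _ μ x) (hgen _ x), pd_rotGen]
  rw [← hsym]
  simp only [hdiv, hEL, Finset.sum_add_distrib, Finset.sum_mul]
  rw [Finset.sum_comm]

end
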